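/- arXiv:1711.03232 — 2 statements merged into one kernel-verified Lean document; each statement's English description precedes it below -/
import Mathlib

section
/- Let A be a linear map from n₁×n₂ real matrices to ℝ^p, let r ≥ 1 be an integer, and let 0 ≤ δ < 1 be such that A satisfies the rank-2r restricted isometry property with constant δ, i.e. (1−δ)·‖X‖_F ≤ ‖A(X)‖₂ ≤ (1+δ)·‖X‖_F for every matrix X of rank at most 2r. Let X₀ be a matrix with rank(X₀) ≤ r and set b = A(X₀). Then X₀ is the only matrix of rank at most r satisfying A(X) = b: every matrix X with rank(X) ≤ r and A(X) = b equals X₀. -/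
/-- The Frobenius norm of a real matrix. -/
noncomputable def frobNorm {n₁ n₂ : ℕ} (X : Matrix (Fin n₁) (Fin n₂) ℝ) : ℝ :=
  Real.sqrt (∑ i, ∑ j, (X i j) ^ 2)

theorem frobNorm_nonneg {n₁ n₂ : ℕ} (X : Matrix (Fin n₁) (Fin n₂) ℝ) : 0 ≤ frobNorm X :=
  Real.sqrt_nonneg _

theorem eq_zero_of_frobNorm_eq_zero {n₁ n₂ : ℕ} {X : Matrix (Fin n₁) (Fin n₂) ℝ}
    (h : frobNorm X = 0) : X = 0 := by
  rw [frobNorm, Real.sqrt_eq_zero (by positivity),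
    Finset.sum_eq_zero_iff_of_nonneg fun i _ => by positivity] at h
  ext i j
  have hi := h i (Finset.mem_univ i)
  rw [Finset.sum_eq_zero_iff_of_nonneg fun j _ => by positivity] at hi
  simpa using hi j (Finset.mem_univ j)

theorem Matrix.rank_sub_le_rank_add_rank {m n : Type*} [Fintype m] [Fintype n]
    {K : Type*} [Field K] (X Y : Matrix m n K) : (X - Y).rank ≤ X.rank + Y.rank := by
  have hle : LinearMap.range (X - Y).mulVecLin ≤
      LinearMap.range X.mulVecLin ⊔ LinearMap.range Y.mulVecLin := by
    rintro _ ⟨v, rfl⟩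
    rw [Matrix.mulVecLin_apply, Matrix.sub_mulVec]
    exact Submodule.sub_mem _ (Submodule.mem_sup_left ⟨v, rfl⟩) (Submodule.mem_sup_right ⟨v, rfl⟩)
  exact (Submodule.finrank_mono hle).trans (Submodule.finrank_add_le_finrank_add_finrank _ _)

/-- If `A` satisfies the rank-`2r` RIP with constant `δ < 1`, then a matrix of rank at most `r`
is uniquely determined by its measurements among matrices of rank at most `r`. -/
theorem rank_minimization_unique_solution {n₁ n₂ p : ℕ}
    (A : Matrix (Fin n₁) (Fin n₂) ℝ →ₗ[ℝ] EuclideanSpace ℝ (Fin p))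
    (r : ℕ) (hr : 1 ≤ r) (δ : ℝ) (hδ₀ : 0 ≤ δ) (hδ₁ : δ < 1)
    (hRIP : ∀ X : Matrix (Fin n₁) (Fin n₂) ℝ, X.rank ≤ 2 * r →
      (1 - δ) * frobNorm X ≤ ‖A X‖ ∧ ‖A X‖ ≤ (1 + δ) * frobNorm X)
    (X₀ : Matrix (Fin n₁) (Fin n₂) ℝ) (hX₀ : X₀.rank ≤ r)
    (b : EuclideanSpace ℝ (Fin p)) (hb : A X₀ = b)
    (X : Matrix (Fin n₁) (Fin n₂) ℝ) (hX : X.rank ≤ r) (hAX : A X = b) :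
    X = X₀ := by
  have hrank : (X - X₀).rank ≤ 2 * r :=
    (Matrix.rank_sub_le_rank_add_rank X X₀).trans (by omega)
  have hlow := (hRIP _ hrank).1
  rw [map_sub, hAX, hb, sub_self, norm_zero] at hlow
  have hle : frobNorm (X - X₀) ≤ 0 := nonpos_of_mul_nonpos_right hlow (sub_pos.mpr hδ₁)
  exact sub_eq_zero.mp (eq_zero_of_frobNorm_eq_zero (hle.antisymm (frobNorm_nonneg _)))
end

section
/- Let 𝓕 be a linear map from n×n complex matrices to ℂ^p and let d ∈ ℂ^p. Suppose the feasible set C = {ρ : ρ is Hermitian positive semidefinite and 𝓕(ρ) = d} is nonempty. Then: (a) the trace attains its minimum over C; (b) among the trace minimizers in C there is a unique matrix ρ₀ of minimal Frobenius norm; and (c) for each λ > 0, letting ρ_λ denote the unique minimizer over C of ρ ↦ Tr(ρ) + (1/λ)·‖ρ‖_F², one has ‖ρ_λ − ρ₀‖_F → 0 as λ → ∞. -/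
open scoped ComplexOrder

/-- The Frobenius norm of a complex square matrix. -/
noncomputable def frobNormC {n : ℕ} (X : Matrix (Fin n) (Fin n) ℂ) : ℝ :=
  Real.sqrt (∑ i, ∑ j, ‖X i j‖ ^ 2)

open Filter Topology in
/-- A linear functional dominating the norm on a nonempty closed convex set attains its minimum
there, has a unique minimizer of least norm, and the minimizers of the Tikhonov regularizations
converge to it as the regularization weight tends to `0`. -/
theorem exists_least_norm_minimizer_tendsto_regularized {E : Type*} [NormedAddCommGroup E]
    [NormedSpace ℝ E] [StrictConvexSpace ℝ E] [ProperSpace E] {C : Set E} (hne : C.Nonempty)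
    (hcl : IsClosed C) (hconv : Convex ℝ C) (T : E →L[ℝ] ℝ) (hT : ∀ x ∈ C, ‖x‖ ≤ T x) :
    ∃ x₀ ∈ C, (∀ x ∈ C, T x₀ ≤ T x) ∧
      (∀ x ∈ C, (∀ y ∈ C, T x ≤ T y) → ‖x₀‖ ≤ ‖x‖ ∧ (‖x‖ = ‖x₀‖ → x = x₀)) ∧
      ∀ u : ℝ → E, (∀ r, 0 < r → u r ∈ C ∧
          ∀ y ∈ C, T (u r) + (1 / r) * ‖u r‖ ^ 2 ≤ T y + (1 / r) * ‖y‖ ^ 2) →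
        Tendsto u atTop (𝓝 x₀) := by
  obtain ⟨m, hmC, hm⟩ : ∃ m ∈ C, ∀ x ∈ C, T m ≤ T x := by
    obtain ⟨c, hc⟩ := hne
    obtain ⟨m, hm, hmin⟩ := ((isCompact_closedBall (0 : E) (T c)).inter_left hcl).exists_isMinOn
      ⟨c, hc, by simpa using hT c hc⟩ T.continuous.continuousOn
    refine ⟨m, hm.1, fun x hx => ?_⟩
    rcases le_total (T x) (T c) with h | h
    · exact hmin ⟨hx, by simpa using (hT x hx).trans h⟩
    · exact (hmin ⟨hc, by simpa using hT c hc⟩).trans h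
  let S : Set E := C ∩ {x | T x ≤ T m}
  have hScl : IsClosed S := hcl.inter (isClosed_le T.continuous continuous_const)
  have hSconv : Convex ℝ S :=
    hconv.inter (convex_halfSpace_le T.toLinearMap.isLinear _)
  obtain ⟨x₀, hx₀, hdist⟩ := hScl.exists_infDist_eq_dist ⟨m, hmC, le_refl (T m)⟩ (0 : E)
  have hnorm : ∀ x ∈ S, ‖x₀‖ ≤ ‖x‖ := fun x hx => by
    simpa [hdist] using Metric.infDist_le_dist_of_mem (x := (0 : E)) hx
  have huniq : ∀ x ∈ S, ‖x‖ = ‖x₀‖ → x = x₀ := fun x hx h => by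
    by_contra hxy
    refine ((norm_midpoint_lt_iff h).2 hxy).not_ge (h.trans_le (hnorm _ ?_))
    rw [smul_add]
    exact hSconv hx hx₀ (by norm_num) (by norm_num) (by norm_num)
  refine ⟨x₀, hx₀.1, fun x hx => hx₀.2.trans (hm x hx), fun x hx hmin => ?_, fun u hu => ?_⟩
  · exact ⟨hnorm x ⟨hx, hmin m hmC⟩, huniq x ⟨hx, hmin m hmC⟩⟩
  have hle : ∀ r, 0 < r → ‖u r‖ ≤ ‖x₀‖ := fun r hr => by
    have h1 := (hu r hr).2 x₀ hx₀.1
    have h2 := hx₀.2.trans (hm _ (hu r hr).1)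
    have h3 : (1 / r) * ‖u r‖ ^ 2 ≤ (1 / r) * ‖x₀‖ ^ 2 := by linarith
    exact (sq_le_sq₀ (norm_nonneg _) (norm_nonneg _)).1
      (le_of_mul_le_mul_left h3 (by positivity))
  have hTle : ∀ r, 0 < r → T (u r) ≤ T m + (1 / r) * ‖x₀‖ ^ 2 := fun r hr => by
    have h1 := (hu r hr).2 x₀ hx₀.1
    have h2 : T x₀ ≤ T m := hx₀.2
    have h3 : 0 ≤ (1 / r) * ‖u r‖ ^ 2 := by positivity
    linarith
  have hbound : Tendsto (fun r : ℝ => T m + (1 / r) * ‖x₀‖ ^ 2) atTop (𝓝 (T m)) := by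
    simpa using tendsto_const_nhds.add (tendsto_inv_atTop_zero.mul_const (‖x₀‖ ^ 2))
  refine (isCompact_closedBall (0 : E) ‖x₀‖).tendsto_nhds_of_unique_mapClusterPt
    ((eventually_gt_atTop 0).mono fun r hr => by simpa using hle r hr) fun y hy hcluster => ?_
  have hyC : y ∈ C := hcl.mem_of_mapClusterPt hcluster
    ((eventually_gt_atTop 0).mono fun r hr => (hu r hr).1)
  have hyT : T y ≤ T m := by
    refine le_of_forall_gt_imp_ge_of_dense fun a ha => ?_
    refine (isClosed_le T.continuous continuous_const).mem_of_mapClusterPt (s := {x | T x ≤ a})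
      hcluster ?_
    filter_upwards [eventually_gt_atTop 0, hbound.eventually_lt_const ha] with r hr hra
    exact (hTle r hr).trans hra.le
  exact huniq y ⟨hyC, hyT⟩ (le_antisymm (by simpa using hy) (hnorm y ⟨hyC, hyT⟩))

open scoped MatrixOrder Matrix.Norms.L2Operator in
theorem Matrix.PosSemidef.exists_eq_conjTranspose_mul_self {n : ℕ}
    {X : Matrix (Fin n) (Fin n) ℂ} (hX : X.PosSemidef) :
    ∃ B : Matrix (Fin n) (Fin n) ℂ, X = B.conjTranspose * B :=
  CStarAlgebra.nonneg_iff_eq_star_mul_self.1 hX.nonneg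

section Frobenius

attribute [local instance] Matrix.frobeniusNormedAddCommGroup Matrix.frobeniusNormedSpace

theorem frobNormC_eq_norm {n : ℕ} (X : Matrix (Fin n) (Fin n) ℂ) : frobNormC X = ‖X‖ := by
  simp [frobNormC, Matrix.frobenius_norm_def, Real.sqrt_eq_rpow]

theorem Matrix.frobenius_norm_mul_self {n : ℕ} (X : Matrix (Fin n) (Fin n) ℂ) :
    ‖X‖ * ‖X‖ = ∑ i, ∑ j, ‖X i j‖ * ‖X i j‖ := by
  rw [← frobNormC_eq_norm, frobNormC, Real.mul_self_sqrt (by positivity)]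
  simp only [sq]

theorem Matrix.frobenius_innerProductSpaceable {n : ℕ} :
    InnerProductSpaceable (Matrix (Fin n) (Fin n) ℂ) where
  parallelogram_identity X Y := by
    simp only [Matrix.frobenius_norm_mul_self, Matrix.add_apply, Matrix.sub_apply,
      Finset.mul_sum, ← Finset.sum_add_distrib]
    refine Finset.sum_congr rfl fun i _ => Finset.sum_congr rfl fun j _ => ?_
    exact parallelogram_law_with_norm_mul ℝ (X i j) (Y i j)

theorem Matrix.PosSemidef.frobenius_norm_le_trace {n : ℕ} {X : Matrix (Fin n) (Fin n) ℂ}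
    (hX : X.PosSemidef) : ‖X‖ ≤ X.trace.re := by
  obtain ⟨B, rfl⟩ := hX.exists_eq_conjTranspose_mul_self
  calc ‖B.conjTranspose * B‖ ≤ ‖B.conjTranspose‖ * ‖B‖ := Matrix.frobenius_norm_mul _ _
    _ = ‖B‖ * ‖B‖ := by rw [Matrix.frobenius_norm_conjTranspose]
    _ = (B.conjTranspose * B).trace.re := by
      rw [Matrix.frobenius_norm_mul_self, Finset.sum_comm]
      simp [Matrix.trace, Matrix.mul_apply, Complex.norm_mul_self_eq_normSq,
        Complex.normSq_apply]

theorem Matrix.isClosed_setOf_posSemidef {n : ℕ} :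
    IsClosed {X : Matrix (Fin n) (Fin n) ℂ | X.PosSemidef} := by
  simp only [Matrix.posSemidef_iff_dotProduct_mulVec, Matrix.IsHermitian, Set.ofPred_and,
    Set.ofPred_forall]
  refine (isClosed_eq (by fun_prop) (by fun_prop)).inter (isClosed_iInter fun x => ?_)
  exact isClosed_le (by fun_prop) (by fun_prop)

end Frobenius

/-- If the feasible set `{ρ PSD : 𝓕 ρ = d}` is nonempty, then (a) the trace attains its
minimum over it, (b) among the trace minimizers there is a unique matrix `ρ₀` of minimal
Frobenius norm, and (c) the unique minimizers `ρ_λ` of `Tr ρ + (1/λ)‖ρ‖_F²` over the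
feasible set converge to `ρ₀` as `λ → ∞`. -/
theorem regularized_trace_minimizers_converge {n p : ℕ}
    (F : Matrix (Fin n) (Fin n) ℂ →ₗ[ℂ] EuclideanSpace ℂ (Fin p))
    (d : EuclideanSpace ℂ (Fin p))
    (hfeas : ∃ ρ : Matrix (Fin n) (Fin n) ℂ, ρ.PosSemidef ∧ F ρ = d) :
    ∃ ρ₀ : Matrix (Fin n) (Fin n) ℂ, ρ₀.PosSemidef ∧ F ρ₀ = d ∧
      -- (a) `ρ₀` minimizes the trace over the feasible set
      (∀ ρ : Matrix (Fin n) (Fin n) ℂ, ρ.PosSemidef → F ρ = d →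
        (ρ₀.trace).re ≤ (ρ.trace).re) ∧
      -- (b) `ρ₀` is the unique trace minimizer of minimal Frobenius norm
      (∀ ρ : Matrix (Fin n) (Fin n) ℂ, ρ.PosSemidef → F ρ = d →
        (∀ σ : Matrix (Fin n) (Fin n) ℂ, σ.PosSemidef → F σ = d →
          (ρ.trace).re ≤ (σ.trace).re) →
        frobNormC ρ₀ ≤ frobNormC ρ ∧ (frobNormC ρ = frobNormC ρ₀ → ρ = ρ₀)) ∧
      -- (c) the regularized minimizers converge to `ρ₀` as `λ → ∞`
      (∀ ρlam : ℝ → Matrix (Fin n) (Fin n) ℂ,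
        (∀ lam : ℝ, 0 < lam → (ρlam lam).PosSemidef ∧ F (ρlam lam) = d ∧
          (∀ σ : Matrix (Fin n) (Fin n) ℂ, σ.PosSemidef → F σ = d →
            ((ρlam lam).trace).re + (1 / lam) * (frobNormC (ρlam lam)) ^ 2 ≤
              (σ.trace).re + (1 / lam) * (frobNormC σ) ^ 2)) →
        Filter.Tendsto (fun lam => frobNormC (ρlam lam - ρ₀)) Filter.atTop (nhds 0)) := by
  let _ := Matrix.frobeniusNormedAddCommGroup (m := Fin n) (n := Fin n) (α := ℂ)
  let _ := Matrix.frobeniusNormedSpace (R := ℝ) (m := Fin n) (n := Fin n) (α := ℂ)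
  have := Matrix.frobenius_innerProductSpaceable (n := n)
  have : ProperSpace (Matrix (Fin n) (Fin n) ℂ) := FiniteDimensional.proper_real _
  have hF : Continuous F := LinearMap.continuous_of_finiteDimensional F
  let T : Matrix (Fin n) (Fin n) ℂ →L[ℝ] ℝ := LinearMap.toContinuousLinearMap
    (Complex.reLm ∘ₗ Matrix.traceLinearMap (Fin n) ℝ ℂ)
  obtain ⟨ρ₀, hρ₀, hmin, huniq, hlim⟩ := exists_least_norm_minimizer_tendsto_regularized
    (C := {ρ : Matrix (Fin n) (Fin n) ℂ | ρ.PosSemidef ∧ F ρ = d}) hfeas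
    (Matrix.isClosed_setOf_posSemidef.inter (isClosed_eq hF continuous_const))
    (fun X hX Y hY a b ha hb hab => ⟨(hX.1.smul ha).add (hY.1.smul hb), by
      rw [map_add, LinearMap.map_smul_of_tower, LinearMap.map_smul_of_tower, hX.2, hY.2,
        ← add_smul, hab, one_smul]⟩)
    T (fun X hX => hX.1.frobenius_norm_le_trace)
  simp only [frobNormC_eq_norm]
  refine ⟨ρ₀, hρ₀.1, hρ₀.2, fun ρ h1 h2 => hmin ρ ⟨h1, h2⟩,
    fun ρ h1 h2 h => huniq ρ ⟨h1, h2⟩ fun σ hσ => h σ hσ.1 hσ.2, fun u hu => ?_⟩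
  refine tendsto_iff_norm_sub_tendsto_zero.1 (hlim u fun r hr => ?_)
  exact ⟨⟨(hu r hr).1, (hu r hr).2.1⟩, fun σ hσ => (hu r hr).2.2 σ hσ.1 hσ.2⟩
end
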